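/- There exists a constant C_Γ > 0, depending only on the Schottky data, such that for every τ ∈ (0,1], every interval J ⊂ ℝ, and every C₀ ≥ 2: #{𝐚 ∈ W° : τ ≤ |I_𝐚| ≤ C₀ τ and I_𝐚 ∩ J ≠ ∅} ≤ C_Γ τ^{-δ} |J|^δ + C_Γ log C₀. -/

import Mathlib

open MeasureTheory Set Real Pointwise

noncomputable section

abbrev SL2 := Matrix.SpecialLinearGroup (Fin 2) ℝ

/-- The Möbius transformation of `ℝ` associated to `g ∈ SL(2,ℝ)` (junk value at the pole). -/
def mobius (g : SL2) (x : ℝ) : ℝ :=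
  (g 0 0 * x + g 0 1) / (g 1 0 * x + g 1 1)

/-- The derivative `γ'(x) = (cx+d)⁻²` of the Möbius transformation. -/
def mobiusDeriv (g : SL2) (x : ℝ) : ℝ :=
  ((g 1 0 * x + g 1 1) ^ 2)⁻¹

/-- The derivative of the Möbius transformation in the ball model,
`|γ'(x)|_B = ((1+x²)/(1+γ(x)²)) γ'(x)`. -/
def mobiusDerivB (g : SL2) (x : ℝ) : ℝ :=
  ((1 + x ^ 2) / (1 + mobius g x ^ 2)) * mobiusDeriv g x

/-- The Möbius action of `SL(2,ℝ)` on `ℝ ∪ {∞}`. -/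
def mobiusOP (g : SL2) (x : OnePoint ℝ) : OnePoint ℝ :=
  Option.elim x
    (if g 1 0 = 0 then OnePoint.infty else ((g 0 0 / g 1 0 : ℝ) : OnePoint ℝ))
    (fun y => if g 1 0 * y + g 1 1 = 0 then OnePoint.infty
      else ((mobius g y : ℝ) : OnePoint ℝ))

/-- The pole `γ⁻¹(∞) = -d/c` of `γ = [[a,b],[c,d]]`. -/
def mobiusPole (g : SL2) : ℝ := -(g 1 1) / (g 1 0)

/-- The distortion factor `α(γ, [x₀,x₁]) = log((γ⁻¹(∞) − x₁)/(γ⁻¹(∞) − x₀))`,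
with the convention `α = 0` when `γ⁻¹(∞) = ∞` (i.e. `c = 0`). -/
def alphaDist (g : SL2) (x₀ x₁ : ℝ) : ℝ :=
  if g 1 0 = 0 then 0 else Real.log ((mobiusPole g - x₁) / (mobiusPole g - x₀))

/-- The letter `ā` paired with `a` in the alphabet `{1,…,2r}` (modelled by `Fin (2r)`). -/
def bar {r : ℕ} (a : Fin (2 * r)) : Fin (2 * r) :=
  if h : (a : ℕ) < r then ⟨(a : ℕ) + r, by omega⟩
  else ⟨(a : ℕ) - r, by have := a.isLt; omega⟩

/-- Schottky data: `2r` disjoint compact intervals `I_a = [ξ₀ a, ξ₁ a]` on the real line and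
transformations `γ_a ∈ SL(2,ℝ)` with `γ_ā = γ_a⁻¹` such that `γ_a` maps the complement (in
`ℝ ∪ {∞}`) of the interior of `I_ā` onto `I_a`. -/
structure SchottkyData (r : ℕ) where
  hr : 2 ≤ r
  ξ₀ : Fin (2 * r) → ℝ
  ξ₁ : Fin (2 * r) → ℝ
  hlt : ∀ a, ξ₀ a < ξ₁ a
  hdisj : ∀ a b, a ≠ b → Disjoint (Icc (ξ₀ a) (ξ₁ a)) (Icc (ξ₀ b) (ξ₁ b))
  γ : Fin (2 * r) → SL2
  hinv : ∀ a, γ (bar a) = (γ a)⁻¹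
  hmap : ∀ a, mobiusOP (γ a) ''
      (univ \ ((fun t : ℝ => (t : OnePoint ℝ)) '' Ioo (ξ₀ (bar a)) (ξ₁ (bar a))))
      = (fun t : ℝ => (t : OnePoint ℝ)) '' Icc (ξ₀ a) (ξ₁ a)

namespace SchottkyData

variable {r : ℕ}

/-- `l` is a word: no letter is followed by its bar. -/
def IsWord (_ : SchottkyData r) (l : List (Fin (2 * r))) : Prop :=
  l.Chain' fun p q => q ≠ bar p

/-- The group element `γ_𝐚 = γ_{a_1} ⋯ γ_{a_n}` of a word. -/
def wordγ (S : SchottkyData r) (l : List (Fin (2 * r))) : SL2 :=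
  (l.map S.γ).prod

/-- The interval `I_𝐚 = γ_{𝐚'}(I_{a_n})` of a nonempty word (and `∅` for the empty word). -/
def wordI (S : SchottkyData r) (l : List (Fin (2 * r))) : Set ℝ :=
  if h : l = [] then ∅
  else mobius (S.wordγ l.dropLast) '' Icc (S.ξ₀ (l.getLast h)) (S.ξ₁ (l.getLast h))

/-- The limit set `Λ_Γ = ⋂_n ⋃_{𝐚 ∈ W_n} I_𝐚`. -/
def limitSet (S : SchottkyData r) : Set ℝ :=
  ⋂ n : ℕ, ⋃ (l : List (Fin (2 * r))) (_ : S.IsWord l ∧ l.length = n + 1), S.wordI l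

/-- `μ` is the (δ-conformal) Patterson–Sullivan measure: a Borel probability measure
supported on the limit set satisfying the equivariance property under the group
generated by the Schottky transformations. -/
def IsPS (S : SchottkyData r) (δ : ℝ) (μ : Measure ℝ) : Prop :=
  IsProbabilityMeasure μ ∧ μ S.limitSetᶜ = 0 ∧
    ∀ g ∈ Subgroup.closure (Set.range S.γ), ∀ f : ℝ → ℝ, Measurable f →
      (∃ C, ∀ x, |f x| ≤ C) →
      ∫ x, f x ∂μ = ∫ x, f (mobius g x) * mobiusDerivB g x ^ δ ∂μ

/-- The partition `Z(τ) = {𝐚 ∈ W° : |I_𝐚| ≤ τ < |I_{𝐚'}|}` (with `|I_∅| = ∞`). -/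
def Zpart (S : SchottkyData r) (τ : ℝ) : Set (List (Fin (2 * r))) :=
  {l | S.IsWord l ∧ l ≠ [] ∧ (MeasureTheory.volume (S.wordI l)).toReal ≤ τ ∧
    (l.dropLast = [] ∨ τ < (MeasureTheory.volume (S.wordI l.dropLast)).toReal)}

end SchottkyData

/-- The length `|I|` of an interval `I ⊂ ℝ`. -/
def ivlen (I : Set ℝ) : ℝ := (MeasureTheory.volume I).toReal

/-- `𝐚 ⇝ 𝐛` : the last letter of `𝐚` equals the first letter of `𝐛`. -/
def chn {X : Type*} (l m : List X) : Prop :=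
  ∃ (h1 : l ≠ []) (h2 : m ≠ []), l.getLast h1 = m.head h2

/-- The center of an interval. -/
def ctr (I : Set ℝ) : ℝ := (sInf I + sSup I) / 2

end

noncomputable section

open MeasureTheory Set Real

/-- The denominator of a Möbius transformation. -/
def qden (g : SL2) (x : ℝ) : ℝ := g 1 0 * x + g 1 1

theorem SL2_det (g : SL2) : g 0 0 * g 1 1 - g 0 1 * g 1 0 = 1 := by
  have h := g.det_coe
  rw [Matrix.det_fin_two] at h
  exact h

theorem qden_mul (g h : SL2) (x : ℝ) (hx : qden h x ≠ 0) :
    qden (g * h) x = qden g (mobius h x) * qden h x := by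
  unfold qden at *
  unfold mobius
  simp only [Matrix.SpecialLinearGroup.coe_mul, Matrix.mul_apply, Fin.sum_univ_two]
  field_simp
  ring

theorem mobius_mul (g h : SL2) (x : ℝ) (hx : qden h x ≠ 0) :
    mobius (g * h) x = mobius g (mobius h x) := by
  have h1 := qden_mul g h x hx
  have h2 : (g * h) 0 0 * x + (g * h) 0 1 =
      (g 0 0 * mobius h x + g 0 1) * qden h x := by
    unfold qden at *
    unfold mobius
    simp only [Matrix.SpecialLinearGroup.coe_mul, Matrix.mul_apply, Fin.sum_univ_two]
    field_simp
    ring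
  have e : mobius (g * h) x = ((g * h) 0 0 * x + (g * h) 0 1) / qden (g * h) x := rfl
  rw [e, h2, h1, mul_div_mul_right _ _ hx]
  rfl

theorem mobius_sub (g : SL2) (x y : ℝ) (hx : qden g x ≠ 0) (hy : qden g y ≠ 0) :
    mobius g y - mobius g x = (y - x) / (qden g x * qden g y) := by
  have hd := SL2_det g
  unfold mobius
  unfold qden at *
  rw [div_sub_div _ _ hy hx, mul_comm (g 1 0 * x + g 1 1)]
  congr 1
  linear_combination (y - x) * hd

theorem mobius_inj (g : SL2) (x y : ℝ) (hx : qden g x ≠ 0) (hy : qden g y ≠ 0)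
    (h : mobius g x = mobius g y) : x = y := by
  have := mobius_sub g x y hx hy
  rw [h, sub_self, eq_comm, div_eq_zero_iff] at this
  rcases this with h | h
  · linarith
  · exact absurd h (mul_ne_zero hx hy)

theorem bar_val {r : ℕ} (a : Fin (2 * r)) :
    ((bar a : Fin (2 * r)) : ℕ) = if (a : ℕ) < r then (a : ℕ) + r else (a : ℕ) - r := by
  unfold bar
  split_ifs <;> rfl

theorem bar_bar {r : ℕ} (a : Fin (2 * r)) : bar (bar a) = a := by
  have := a.isLt
  ext
  rw [bar_val, bar_val]
  split_ifs <;> omega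

theorem bar_ne {r : ℕ} {a b : Fin (2 * r)} (h : b ≠ bar a) : a ≠ bar b := by
  intro h'
  apply h
  rw [h', bar_bar]

theorem exists_pos_le {ι : Type*} [Finite ι] (f : ι → ℝ) (hf : ∀ i, 0 < f i) :
    ∃ e > 0, ∀ i, e ≤ f i := by
  cases nonempty_fintype ι
  rcases isEmpty_or_nonempty ι with h | h
  · exact ⟨1, one_pos, fun i => h.elim i⟩
  · obtain ⟨i, hi⟩ := Finite.exists_min f
    exact ⟨f i, hf i, hi⟩

theorem exists_ge {ι : Type*} [Finite ι] (f : ι → ℝ) : ∃ e > 0, ∀ i, f i ≤ e := by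
  rcases isEmpty_or_nonempty ι with h | h
  · exact ⟨1, one_pos, fun i => h.elim i⟩
  · obtain ⟨i, hi⟩ := Finite.exists_max f
    exact ⟨max (f i) 1, by positivity, fun j => (hi j).trans (le_max_left _ _)⟩

namespace SchottkyData

variable {r : ℕ} (S : SchottkyData r)

/-- The basic interval of a letter. -/
def BI (a : Fin (2 * r)) : Set ℝ := Icc (S.ξ₀ a) (S.ξ₁ a)

theorem BI_ne {a b : Fin (2 * r)} {x y : ℝ} (h : a ≠ b) (hx : x ∈ S.BI a) (hy : y ∈ S.BI b) :
    x ≠ y := by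
  rintro rfl
  exact (Set.disjoint_left.1 (S.hdisj a b h)) hx hy

theorem letter_map {s b : Fin (2 * r)} (h : b ≠ bar s) {x : ℝ} (hx : x ∈ S.BI b) :
    qden (S.γ s) x ≠ 0 ∧ mobius (S.γ s) x ∈ S.BI s := by
  have h1 : mobiusOP (S.γ s) (x : OnePoint ℝ) ∈
      (fun t : ℝ => (t : OnePoint ℝ)) '' Icc (S.ξ₀ s) (S.ξ₁ s) := by
    rw [← S.hmap s]
    refine ⟨_, ⟨mem_univ _, ?_⟩, rfl⟩
    rintro ⟨t, ht, hte⟩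
    have : t = x := OnePoint.coe_injective hte
    subst this
    exact S.BI_ne h hx (Ioo_subset_Icc_self ht) rfl
  obtain ⟨t, ht, hte⟩ := h1
  have e : mobiusOP (S.γ s) (x : OnePoint ℝ) = if qden (S.γ s) x = 0 then OnePoint.infty
      else ((mobius (S.γ s) x : ℝ) : OnePoint ℝ) := rfl
  rw [e] at hte
  split_ifs at hte with hq
  · exact absurd hte (OnePoint.coe_ne_infty t)
  · refine ⟨hq, ?_⟩
    rw [← OnePoint.coe_injective hte]
    exact ht

theorem letter_infty (s : Fin (2 * r)) :
    (S.γ s) 1 0 ≠ 0 ∧ (S.γ s) 0 0 / (S.γ s) 1 0 ∈ S.BI s := by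
  have h1 : mobiusOP (S.γ s) OnePoint.infty ∈
      (fun t : ℝ => (t : OnePoint ℝ)) '' Icc (S.ξ₀ s) (S.ξ₁ s) := by
    rw [← S.hmap s]
    refine ⟨_, ⟨mem_univ _, ?_⟩, rfl⟩
    rintro ⟨t, ht, hte⟩
    exact absurd hte (OnePoint.coe_ne_infty t)
  obtain ⟨t, ht, hte⟩ := h1
  have e : mobiusOP (S.γ s) OnePoint.infty = if (S.γ s) 1 0 = 0 then OnePoint.infty
      else (((S.γ s) 0 0 / (S.γ s) 1 0 : ℝ) : OnePoint ℝ) := rfl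
  rw [e] at hte
  split_ifs at hte with hq
  · exact absurd hte (OnePoint.coe_ne_infty t)
  · refine ⟨hq, ?_⟩
    rw [← OnePoint.coe_injective hte]
    exact ht

theorem gamma_bar (s : Fin (2 * r)) : (S.γ (bar s)) 0 0 = (S.γ s) 1 1 ∧
    (S.γ (bar s)) 0 1 = - (S.γ s) 0 1 ∧ (S.γ (bar s)) 1 0 = - (S.γ s) 1 0 ∧
    (S.γ (bar s)) 1 1 = (S.γ s) 0 0 := by
  rw [S.hinv, Matrix.SpecialLinearGroup.SL2_inv_expl]
  simp

theorem wordγ_concat (l : List (Fin (2 * r))) (s : Fin (2 * r)) :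
    S.wordγ (l ++ [s]) = S.wordγ l * S.γ s := by
  simp [wordγ]

theorem isWord_left {l t : List (Fin (2 * r))} (h : S.IsWord (l ++ t)) : S.IsWord l :=
  List.IsChain.left_of_append h

theorem isWord_concat {l : List (Fin (2 * r))} {s b : Fin (2 * r)} :
    S.IsWord (l ++ [s] ++ [b]) ↔ S.IsWord (l ++ [s]) ∧ b ≠ bar s := by
  unfold IsWord
  unfold List.Chain'
  rw [List.isChain_append]
  simp

/-- position of the pole -/
theorem pole (l : List (Fin (2 * r))) : ∀ s, S.IsWord (l ++ [s]) →
    (S.wordγ (l ++ [s])) 1 0 ≠ 0 ∧ ∃ p ∈ S.BI (bar s), ∀ x, qden (S.wordγ (l ++ [s])) x =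
      (S.wordγ (l ++ [s])) 1 0 * (x - p) := by
  induction l using List.reverseRecOn with
  | nil =>
    intro s _
    obtain ⟨h1, h2⟩ := S.letter_infty (bar s)
    obtain ⟨e1, e2, e3, e4⟩ := S.gamma_bar s
    rw [e3] at h1 h2
    rw [e1] at h2
    have hc : (S.γ s) 1 0 ≠ 0 := by simpa using h1
    have e : S.wordγ ([] ++ [s]) = S.γ s := by simp [wordγ]
    rw [e]
    refine ⟨hc, _, h2, fun x => ?_⟩
    unfold qden
    field_simp
    ring
  | append_singleton l t ih =>
    intro s hs
    rw [isWord_concat] at hs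
    obtain ⟨hw, hst⟩ := hs
    obtain ⟨h1, p, hp, hq⟩ := ih t hw
    have hne : bar t ≠ bar (bar s) := by
      rw [bar_bar]
      exact hst.symm
    obtain ⟨k1, k2⟩ := S.letter_map hne hp
    obtain ⟨e1, e2, e3, e4⟩ := S.gamma_bar s
    rw [S.wordγ_concat (l ++ [t]) s]
    have hd : (S.wordγ (l ++ [t])) 1 1 = - (S.wordγ (l ++ [t])) 1 0 * p := by
      have := hq 0
      unfold qden at this
      linarith
    have hc : (S.wordγ (l ++ [t]) * S.γ s) 1 0 =
        (S.wordγ (l ++ [t])) 1 0 * qden (S.γ (bar s)) p := by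
      unfold qden
      rw [e3, e4]
      simp only [Matrix.SpecialLinearGroup.coe_mul, Matrix.mul_apply, Fin.sum_univ_two]
      rw [hd]
      ring
    refine ⟨?_, _, k2, fun x => ?_⟩
    · rw [hc]
      exact mul_ne_zero h1 k1
    · have hD : (S.wordγ (l ++ [t]) * S.γ s) 1 1 = - (S.wordγ (l ++ [t]) * S.γ s) 1 0 *
          mobius (S.γ (bar s)) p := by
        rw [hc]
        have : qden (S.γ (bar s)) p * mobius (S.γ (bar s)) p =
            (S.γ (bar s)) 0 0 * p + (S.γ (bar s)) 0 1 := by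
          unfold mobius
          exact mul_div_cancel₀ _ k1
        rw [neg_mul, mul_assoc, this, e1, e2]
        simp only [Matrix.SpecialLinearGroup.coe_mul, Matrix.mul_apply, Fin.sum_univ_two]
        rw [hd]
        ring
      unfold qden
      rw [hD]
      ring

theorem wordI_concat (l : List (Fin (2 * r))) (b : Fin (2 * r)) :
    S.wordI (l ++ [b]) = mobius (S.wordγ l) '' S.BI b := by
  simp [wordI, BI]

theorem wordI_single (b : Fin (2 * r)) : S.wordI [b] = S.BI b := by
  have h := S.wordI_concat [] b
  simp only [List.nil_append] at h
  rw [h]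
  simp [wordγ]
  have : mobius 1 = id := by
    funext x
    simp [mobius]
  rw [this, image_id]

theorem qden_one (x : ℝ) : qden 1 x = 1 := by simp [qden]

theorem qden_ne {l : List (Fin (2 * r))} {b : Fin (2 * r)} (h : S.IsWord (l ++ [b])) {x : ℝ}
    (hx : x ∈ S.BI b) : qden (S.wordγ l) x ≠ 0 := by
  rcases List.eq_nil_or_concat' l with rfl | ⟨l, s, rfl⟩
  · simp [wordγ, qden_one]
  · rw [isWord_concat] at h
    obtain ⟨h1, p, hp, hq⟩ := S.pole l s h.1
    rw [hq]
    exact mul_ne_zero h1 (sub_ne_zero.2 (S.BI_ne h.2 hx hp))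

theorem wordI_child {l : List (Fin (2 * r))} {s b : Fin (2 * r)}
    (h : S.IsWord (l ++ [s] ++ [b])) : S.wordI (l ++ [s] ++ [b]) =
      mobius (S.wordγ l) '' (mobius (S.γ s) '' S.BI b) := by
  rw [isWord_concat] at h
  rw [wordI_concat, image_image, wordγ_concat]
  exact image_congr fun x hx => mobius_mul _ _ _ (S.letter_map h.2 hx).1

theorem wordI_child_subset {l : List (Fin (2 * r))} {s b : Fin (2 * r)}
    (h : S.IsWord (l ++ [s] ++ [b])) : S.wordI (l ++ [s] ++ [b]) ⊆ S.wordI (l ++ [s]) := by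
  rw [S.wordI_child h, wordI_concat]
  rw [isWord_concat] at h
  apply image_mono
  rintro _ ⟨x, hx, rfl⟩
  exact (S.letter_map h.2 hx).2

theorem wordI_prefix {l : List (Fin (2 * r))} (hl : l ≠ []) (t : List (Fin (2 * r))) :
    S.IsWord (l ++ t) → S.wordI (l ++ t) ⊆ S.wordI l := by
  induction t using List.reverseRecOn with
  | nil => intro _; simp
  | append_singleton t b ih =>
    intro h
    rw [← List.append_assoc] at h ⊢
    refine Subset.trans ?_ (ih (S.isWord_left h))
    obtain ⟨m, s, e⟩ : ∃ m s, l ++ t = m ++ [s] := by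
      rcases List.eq_nil_or_concat' (l ++ t) with h | ⟨m, s, h⟩
      · simp at h
        exact absurd h.1 hl
      · exact ⟨m, s, h⟩
    rw [e] at h ⊢
    exact S.wordI_child_subset h

theorem wordI_mono {l m : List (Fin (2 * r))} (hl : l ≠ []) (hm : S.IsWord m) (h : l <+: m) :
    S.wordI m ⊆ S.wordI l := by
  obtain ⟨t, rfl⟩ := h
  exact S.wordI_prefix hl t hm

theorem wordI_sub_BI {l : List (Fin (2 * r))} (hl : l ≠ []) (hm : S.IsWord l) :
    ∃ b, S.wordI l ⊆ S.BI b := by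
  cases l with
  | nil => exact absurd rfl hl
  | cons b t =>
    refine ⟨b, ?_⟩
    rw [← wordI_single]
    exact S.wordI_mono (by simp) hm ⟨t, rfl⟩

theorem sibling_disjoint {p : List (Fin (2 * r))} {b c : Fin (2 * r)} (hbc : b ≠ c)
    (hb : S.IsWord (p ++ [b])) (hc : S.IsWord (p ++ [c])) :
    Disjoint (S.wordI (p ++ [b])) (S.wordI (p ++ [c])) := by
  rw [Set.disjoint_left]
  rw [wordI_concat, wordI_concat]
  rintro _ ⟨x, hx, rfl⟩ ⟨y, hy, h⟩
  exact S.BI_ne hbc hx hy (mobius_inj _ _ _ (S.qden_ne hb hx) (S.qden_ne hc hy) h.symm)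

end SchottkyData

theorem prefix_or_branch {X : Type*} (l : List X) : ∀ m : List X, l <+: m ∨ m <+: l ∨
    ∃ p b c t u, b ≠ c ∧ l = p ++ [b] ++ t ∧ m = p ++ [c] ++ u := by
  induction l with
  | nil => intro m; left; exact List.nil_prefix
  | cons a l ih =>
    intro m
    cases m with
    | nil => right; left; exact List.nil_prefix
    | cons a' m =>
      by_cases h : a = a'
      · subst h
        rcases ih m with h | h | ⟨p, b, c, t, u, h1, h2, h3⟩
        · left; simpa using h
        · right; left; simpa using h
        · right; right
          exact ⟨a :: p, b, c, t, u, h1, by simp [h2], by simp [h3]⟩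
      · right; right
        exact ⟨[], a, a', l, m, h, by simp, by simp⟩

theorem SchottkyData.comparable {r : ℕ} (S : SchottkyData r) {l m : List (Fin (2 * r))}
    (hl : S.IsWord l) (hm : S.IsWord m) {x : ℝ} (hxl : x ∈ S.wordI l) (hxm : x ∈ S.wordI m) :
    l <+: m ∨ m <+: l := by
  rcases prefix_or_branch l m with h | h | ⟨p, b, c, t, u, h1, h2, h3⟩
  · exact Or.inl h
  · exact Or.inr h
  · exfalso
    subst h2 h3
    have hb := S.wordI_prefix (by simp) _ hl hxl
    have hc := S.wordI_prefix (by simp) _ hm hxm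
    exact Set.disjoint_left.1 (S.sibling_disjoint h1 (S.isWord_left hl) (S.isWord_left hm)) hb hc

namespace SchottkyData

variable {r : ℕ} (S : SchottkyData r)

theorem gap_const : ∃ d > 0, ∀ a b, a ≠ b → ∀ x ∈ S.BI a, ∀ y ∈ S.BI b, d ≤ |x - y| := by
  obtain ⟨d, hd, h⟩ := exists_pos_le (ι := {p : Fin (2 * r) × Fin (2 * r) // p.1 ≠ p.2})
    (fun p => max (S.ξ₀ p.1.2 - S.ξ₁ p.1.1) (S.ξ₀ p.1.1 - S.ξ₁ p.1.2)) (by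
      rintro ⟨⟨a, b⟩, hab⟩
      by_contra hcon
      simp only [not_lt, max_le_iff, sub_nonpos] at hcon
      have ha := S.hlt a
      have hb := S.hlt b
      refine S.BI_ne hab (x := max (S.ξ₀ a) (S.ξ₀ b)) (y := max (S.ξ₀ a) (S.ξ₀ b)) ?_ ?_ rfl
      · exact ⟨le_max_left _ _, max_le ha.le hcon.1⟩
      · exact ⟨le_max_right _ _, max_le hcon.2 hb.le⟩)
  refine ⟨d, hd, fun a b hab x hx y hy => ?_⟩
  have := h ⟨(a, b), hab⟩
  simp only [le_max_iff] at this
  obtain ⟨h1, h2⟩ := hx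
  obtain ⟨h3, h4⟩ := hy
  rcases this with h | h
  · rw [abs_sub_comm]
    exact le_trans (by linarith) (le_abs_self _)
  · exact le_trans (by linarith) (le_abs_self _)

theorem bnd_const : ∃ M > 0, ∀ a, ∀ x ∈ S.BI a, |x| ≤ M := by
  obtain ⟨M, hM, h⟩ := exists_ge (fun a => |S.ξ₀ a| + |S.ξ₁ a|)
  refine ⟨M, hM, fun a x hx => ?_⟩
  have := h a
  obtain ⟨h1, h2⟩ := hx
  rw [abs_le]
  have := neg_abs_le (S.ξ₀ a)
  have := le_abs_self (S.ξ₁ a)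
  have := abs_nonneg (S.ξ₀ a)
  have := abs_nonneg (S.ξ₁ a)
  constructor <;> linarith

theorem len_const : ∃ m > 0, ∀ a, m ≤ S.ξ₁ a - S.ξ₀ a :=
  exists_pos_le _ fun a => sub_pos.2 (S.hlt a)

theorem Q_const : ∃ Q > 0, ∀ s b, b ≠ bar s → ∀ x ∈ S.BI b, |qden (S.γ s) x| ≤ Q := by
  obtain ⟨M, hM, h⟩ := S.bnd_const
  obtain ⟨Q, hQ, h'⟩ := exists_ge (fun s => |S.γ s 1 0| * M + |S.γ s 1 1|)
  refine ⟨Q, hQ, fun s b _ x hx => le_trans ?_ (h' s)⟩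
  unfold qden
  refine (abs_add_le _ _).trans ?_
  rw [abs_mul]
  gcongr
  exact h b x hx

theorem ratio_const : ∃ K ≥ 1, ∀ l b, S.IsWord (l ++ [b]) → ∀ x ∈ S.BI b, ∀ y ∈ S.BI b,
    0 < qden (S.wordγ l) x * qden (S.wordγ l) y ∧
      |qden (S.wordγ l) x| ≤ K * |qden (S.wordγ l) y| := by
  obtain ⟨M, hM, hb⟩ := S.bnd_const
  obtain ⟨d, hd, hg⟩ := S.gap_const
  refine ⟨max 1 (2 * M / d), le_max_left _ _, fun l b h x hx y hy => ?_⟩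
  rcases List.eq_nil_or_concat' l with rfl | ⟨l, s, rfl⟩
  · simp [wordγ, qden_one]
  · rw [isWord_concat] at h
    obtain ⟨h1, p, hp, hq⟩ := S.pole l s h.1
    have hgx := hg _ _ h.2 x hx p hp
    have hgy := hg _ _ h.2 y hy p hp
    rw [hq, hq]
    constructor
    · have : 0 < (x - p) * (y - p) := by
        by_contra hcon
        have hpm : p ∈ S.BI b := by
          rcases mul_nonpos_iff.1 (not_lt.1 hcon) with h | h
          · exact ⟨hy.1.trans (by linarith), le_trans (by linarith) hx.2⟩
          · exact ⟨hx.1.trans (by linarith), le_trans (by linarith) hy.2⟩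
        exact S.BI_ne h.2 hpm hp rfl
      have h2 : 0 < ((S.wordγ (l ++ [s])) 1 0) ^ 2 := by positivity
      nlinarith [mul_pos h2 this]
    · rw [abs_mul, abs_mul]
      have h3 : |x - p| ≤ 2 * M := by
        have := abs_sub x p
        have := hb _ x hx
        have := hb _ p hp
        linarith
      have h4 : |x - p| ≤ max 1 (2 * M / d) * |y - p| := by
        calc |x - p| ≤ 2 * M := h3
          _ = (2 * M / d) * d := by field_simp
          _ ≤ max 1 (2 * M / d) * |y - p| := by
            gcongr
            exact le_max_right _ _
      calc _ ≤ |(S.wordγ (l ++ [s])) 1 0| * (max 1 (2 * M / d) * |y - p|) := by gcongr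
        _ = _ := by ring

theorem wordI_Icc {l : List (Fin (2 * r))} {b : Fin (2 * r)} (h : S.IsWord (l ++ [b])) :
    S.wordI (l ++ [b]) =
      Icc (mobius (S.wordγ l) (S.ξ₀ b)) (mobius (S.wordγ l) (S.ξ₁ b)) := by
  rw [wordI_concat]
  have hb := S.hlt b
  obtain ⟨K, hK, hr⟩ := S.ratio_const
  have hmono : MonotoneOn (mobius (S.wordγ l)) (S.BI b) := by
    intro x hx y hy hxy
    have := mobius_sub _ x y (S.qden_ne h hx) (S.qden_ne h hy)
    have h2 := (hr l b h x hx y hy).1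
    have : 0 ≤ (y - x) / (qden (S.wordγ l) x * qden (S.wordγ l) y) :=
      div_nonneg (by linarith) h2.le
    linarith
  have hcont : ContinuousOn (mobius (S.wordγ l)) (S.BI b) := by
    unfold mobius
    refine ContinuousOn.div (by fun_prop) (by fun_prop) fun x hx => S.qden_ne h hx
  apply Subset.antisymm
  · rintro _ ⟨x, hx, rfl⟩
    exact ⟨hmono (left_mem_Icc.2 hb.le) hx hx.1, hmono hx (right_mem_Icc.2 hb.le) hx.2⟩
  · exact intermediate_value_Icc hb.le hcont

theorem ivlen_eq {l : List (Fin (2 * r))} {b : Fin (2 * r)} (h : S.IsWord (l ++ [b])) :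
    ivlen (S.wordI (l ++ [b])) =
      |S.ξ₁ b - S.ξ₀ b| / |qden (S.wordγ l) (S.ξ₀ b) * qden (S.wordγ l) (S.ξ₁ b)| ∧
    ivlen (S.wordI (l ++ [b])) =
      |mobius (S.wordγ l) (S.ξ₁ b) - mobius (S.wordγ l) (S.ξ₀ b)| := by
  have hb := S.hlt b
  obtain ⟨K, hK, hr⟩ := S.ratio_const
  have h0 : S.ξ₀ b ∈ S.BI b := left_mem_Icc.2 hb.le
  have h1 : S.ξ₁ b ∈ S.BI b := right_mem_Icc.2 hb.le
  have h2 := (hr l b h _ h0 _ h1).1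
  have e := mobius_sub _ _ _ (S.qden_ne h h0) (S.qden_ne h h1)
  have h3 : 0 ≤ mobius (S.wordγ l) (S.ξ₁ b) - mobius (S.wordγ l) (S.ξ₀ b) := by
    rw [e]
    exact div_nonneg (by linarith) h2.le
  have e2 : ivlen (S.wordI (l ++ [b])) =
      |mobius (S.wordγ l) (S.ξ₁ b) - mobius (S.wordγ l) (S.ξ₀ b)| := by
    unfold ivlen
    rw [S.wordI_Icc h, Real.volume_Icc, ENNReal.toReal_ofReal h3, abs_of_nonneg h3]
  refine ⟨?_, e2⟩
  rw [e2, e, abs_div]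

theorem distortion : ∃ k > 0, ∀ l b, S.IsWord (l ++ [b]) → 0 < ivlen (S.wordI (l ++ [b])) ∧
    ∀ x ∈ S.BI b,
      (∀ y ∈ S.BI b, k * ivlen (S.wordI (l ++ [b])) * |y - x| ≤
        |mobius (S.wordγ l) y - mobius (S.wordγ l) x|) ∧
      k * ivlen (S.wordI (l ++ [b])) ≤ mobiusDerivB (S.wordγ l) x ∧
      k * mobiusDerivB (S.wordγ l) x ≤ ivlen (S.wordI (l ++ [b])) := by
  obtain ⟨K, hK, hr⟩ := S.ratio_const
  obtain ⟨M, hM, hbd⟩ := S.bnd_const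
  obtain ⟨m, hm, hlen⟩ := S.len_const
  have hK0 : 0 < K := by linarith
  have key : ∃ k > 0, k * (2 * M) * K ^ 2 * (1 + M ^ 2) ≤ 1 ∧ k * K ^ 2 * (1 + M ^ 2) ≤ m := by
    refine ⟨min (1 / ((2 * M) * K ^ 2 * (1 + M ^ 2))) (m / (K ^ 2 * (1 + M ^ 2))),
      by positivity, ?_, ?_⟩
    · calc _ = min (1 / ((2 * M) * K ^ 2 * (1 + M ^ 2))) (m / (K ^ 2 * (1 + M ^ 2))) *
            ((2 * M) * K ^ 2 * (1 + M ^ 2)) := by ring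
        _ ≤ (1 / ((2 * M) * K ^ 2 * (1 + M ^ 2))) * ((2 * M) * K ^ 2 * (1 + M ^ 2)) := by
          gcongr; exact min_le_left _ _
        _ = 1 := by field_simp
    · calc _ = min (1 / ((2 * M) * K ^ 2 * (1 + M ^ 2))) (m / (K ^ 2 * (1 + M ^ 2))) *
            (K ^ 2 * (1 + M ^ 2)) := by ring
        _ ≤ (m / (K ^ 2 * (1 + M ^ 2))) * (K ^ 2 * (1 + M ^ 2)) := by
          gcongr; exact min_le_right _ _
        _ = m := by field_simp
  obtain ⟨k, hk, hk1, hk2⟩ := key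
  have hK2 : 1 ≤ K ^ 2 := one_le_pow₀ hK
  refine ⟨k, hk, fun l b h => ?_⟩
  have hb := S.hlt b
  have h0 : S.ξ₀ b ∈ S.BI b := left_mem_Icc.2 hb.le
  have h1 : S.ξ₁ b ∈ S.BI b := right_mem_Icc.2 hb.le
  rw [(S.ivlen_eq h).1]
  set q := qden (S.wordγ l) with hq
  have hL : 0 < |S.ξ₁ b - S.ξ₀ b| := abs_pos.2 (by linarith)
  have hLm : m ≤ |S.ξ₁ b - S.ξ₀ b| := (hlen b).trans (le_abs_self _)
  have hLM : |S.ξ₁ b - S.ξ₀ b| ≤ 2 * M := by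
    have := abs_sub (S.ξ₁ b) (S.ξ₀ b)
    have := hbd _ _ h0
    have := hbd _ _ h1
    linarith
  generalize |S.ξ₁ b - S.ξ₀ b| = L at *
  have hA : 0 < |q (S.ξ₀ b) * q (S.ξ₁ b)| :=
    abs_pos.2 (mul_ne_zero (S.qden_ne h h0) (S.qden_ne h h1))
  have hup : ∀ x ∈ S.BI b, ∀ y ∈ S.BI b, |q x * q y| ≤ K ^ 2 * |q (S.ξ₀ b) * q (S.ξ₁ b)| := by
    intro x hx y hy
    rw [abs_mul, abs_mul]
    calc |q x| * |q y| ≤ (K * |q (S.ξ₀ b)|) * (K * |q (S.ξ₁ b)|) := by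
          gcongr
          · exact (hr l b h x hx _ h0).2
          · exact (hr l b h y hy _ h1).2
      _ = _ := by ring
  have hdn : ∀ x ∈ S.BI b, |q (S.ξ₀ b) * q (S.ξ₁ b)| ≤ K ^ 2 * |q x * q x| := by
    intro x hx
    rw [abs_mul, abs_mul]
    calc _ ≤ (K * |q x|) * (K * |q x|) := by
          gcongr
          · exact (hr l b h _ h0 _ hx).2
          · exact (hr l b h _ h1 _ hx).2
      _ = _ := by ring
  generalize |q (S.ξ₀ b) * q (S.ξ₁ b)| = A at *
  refine ⟨div_pos hL hA, fun x hx => ⟨fun y hy => ?_, ?_, ?_⟩⟩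
  · have hqx := S.qden_ne h hx
    have hqy := S.qden_ne h hy
    have hpos : 0 < |q x * q y| := abs_pos.2 (mul_ne_zero hqx hqy)
    rw [mobius_sub _ x y hqx hqy, abs_div, le_div_iff₀ hpos]
    calc k * (L / A) * |y - x| * |q x * q y| ≤ k * ((2 * M) / A) * |y - x| * (K ^ 2 * A) := by
          gcongr
          exact hup x hx y hy
      _ = (k * (2 * M) * K ^ 2) * |y - x| := by field_simp
      _ ≤ 1 * |y - x| := by
          gcongr
          refine le_trans ?_ hk1
          exact le_mul_of_one_le_right (by positivity) (by nlinarith)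
      _ = |y - x| := one_mul _
  all_goals
    have hqx := S.qden_ne h hx
    have hpos : 0 < |q x * q x| := abs_pos.2 (mul_ne_zero hqx hqx)
    have e : mobiusDerivB (S.wordγ l) x =
        ((1 + x ^ 2) / (1 + mobius (S.wordγ l) x ^ 2)) * (|q x * q x|)⁻¹ := by
      unfold mobiusDerivB mobiusDeriv
      rw [abs_mul_self, ← pow_two]
      rfl
    have hgx : |mobius (S.wordγ l) x| ≤ M := by
      obtain ⟨c, hc⟩ := S.wordI_sub_BI (by simp) h
      apply hbd c
      apply hc
      rw [wordI_concat]
      exact ⟨x, hx, rfl⟩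
    have hxM := hbd b x hx
    have hgx2 : mobius (S.wordγ l) x ^ 2 ≤ M ^ 2 := sq_le_sq' (abs_le.1 hgx).1 (abs_le.1 hgx).2
    have hx2 : x ^ 2 ≤ M ^ 2 := sq_le_sq' (abs_le.1 hxM).1 (abs_le.1 hxM).2
    have hux := hup x hx x hx
    have hdx := hdn x hx
    rw [e]
    generalize |q x * q x| = B at *
    have hG0 : 0 ≤ mobius (S.wordγ l) x ^ 2 := sq_nonneg _
    have hX0 : 0 ≤ x ^ 2 := sq_nonneg _
    generalize mobius (S.wordγ l) x ^ 2 = G at *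
    generalize x ^ 2 = X at *
  · calc k * (L / A) ≤ k * ((2 * M) / A) := by gcongr
      _ = (k * (2 * M) * K ^ 2 * (1 + M ^ 2)) * ((1 + 0) / (1 + M ^ 2) * (K ^ 2 * A)⁻¹) := by
        field_simp
        ring
      _ ≤ 1 * ((1 + X) / (1 + G) * B⁻¹) := by gcongr
      _ = _ := one_mul _
  · have hB : B⁻¹ ≤ K ^ 2 / A := by
      rw [inv_eq_one_div, div_le_div_iff₀ hpos hA]
      linarith
    calc k * ((1 + X) / (1 + G) * B⁻¹) ≤ k * ((1 + M ^ 2) / (1 + 0) * (K ^ 2 / A)) := by gcongr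
      _ = (k * K ^ 2 * (1 + M ^ 2)) / A := by
        field_simp
        ring
      _ ≤ L / A := by
        gcongr
        linarith

end SchottkyData

theorem exists_third {r : ℕ} (hr : 2 ≤ r) (u v : Fin (2 * r)) : ∃ c, c ≠ u ∧ c ≠ v := by
  by_contra! hcon
  have h : (Finset.univ : Finset (Fin (2 * r))) ⊆ {u, v} := by
    intro c _
    by_cases h : c = u
    · simp [h]
    · simp [hcon c h]
  have h1 := Finset.card_le_card h
  have h2 : ({u, v} : Finset (Fin (2 * r))).card ≤ 2 := Finset.card_le_two
  simp at h1
  omega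

namespace SchottkyData

variable {r : ℕ} (S : SchottkyData r)

theorem exists_concat {l : List (Fin (2 * r))} (hl : l ≠ []) : ∃ m s, l = m ++ [s] := by
  rcases List.eq_nil_or_concat' l with h | ⟨m, s, h⟩
  · exact absurd h hl
  · exact ⟨m, s, h⟩

theorem ivlen_pos {l : List (Fin (2 * r))} (hl : l ≠ []) (h : S.IsWord l) :
    0 < ivlen (S.wordI l) := by
  obtain ⟨m, s, rfl⟩ := exists_concat hl
  obtain ⟨k, hk, hd⟩ := S.distortion
  exact (hd _ _ h).1

theorem exists_Icc {l : List (Fin (2 * r))} (hl : l ≠ []) (h : S.IsWord l) :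
    ∃ u v, S.wordI l = Icc u v := by
  obtain ⟨m, s, rfl⟩ := exists_concat hl
  exact ⟨_, _, S.wordI_Icc h⟩

theorem letter_sep : ∃ e > 0, ∀ s b c, b ≠ bar s → c ≠ bar s → ∀ x ∈ S.BI b, ∀ y ∈ S.BI c,
    e * |x - y| ≤ |mobius (S.γ s) x - mobius (S.γ s) y| := by
  obtain ⟨Q, hQ, h⟩ := S.Q_const
  refine ⟨1 / Q ^ 2, by positivity, fun s b c hb hc x hx y hy => ?_⟩
  have h1 := (S.letter_map hb hx).1
  have h2 := (S.letter_map hc hy).1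
  rw [mobius_sub _ y x h2 h1, abs_div, le_div_iff₀ (abs_pos.2 (mul_ne_zero h2 h1)), abs_mul]
  calc _ ≤ 1 / Q ^ 2 * |x - y| * (Q * Q) := by
        gcongr
        · exact h s c hc y hy
        · exact h s b hb x hx
    _ = |x - y| := by field_simp

theorem separation : ∃ e > 0, ∀ p : List (Fin (2 * r)), p ≠ [] → ∀ b c, b ≠ c →
    S.IsWord (p ++ [b]) → S.IsWord (p ++ [c]) → ∀ x ∈ S.wordI (p ++ [b]),
    ∀ y ∈ S.wordI (p ++ [c]), e * ivlen (S.wordI p) ≤ |x - y| := by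
  obtain ⟨e, he, hsep⟩ := S.letter_sep
  obtain ⟨k, hk, hd⟩ := S.distortion
  obtain ⟨d, hd0, hg⟩ := S.gap_const
  refine ⟨k * (e * d), by positivity, fun p hp b c hbc hb hc x hx y hy => ?_⟩
  obtain ⟨l, s, rfl⟩ := exists_concat hp
  rw [S.wordI_child hb] at hx
  rw [S.wordI_child hc] at hy
  rw [isWord_concat] at hb hc
  obtain ⟨_, ⟨u, hu, rfl⟩, rfl⟩ := hx
  obtain ⟨_, ⟨v, hv, rfl⟩, rfl⟩ := hy
  have h1 := hsep s b c hb.2 hc.2 u hu v hv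
  have h2 := hg b c hbc u hu v hv
  obtain ⟨hpos, h3⟩ := hd l s hb.1
  have h4 := (h3 _ (S.letter_map hc.2 hv).2).1 _ (S.letter_map hb.2 hu).2
  refine le_trans ?_ h4
  calc _ = k * ivlen (S.wordI (l ++ [s])) * (e * d) := by ring
    _ ≤ k * ivlen (S.wordI (l ++ [s])) * (e * |u - v|) := by gcongr
    _ ≤ _ := by gcongr

theorem contraction_step : ∃ ρ > 0, ρ < 1 ∧ ∀ l s b, S.IsWord (l ++ [s] ++ [b]) →
    ivlen (S.wordI (l ++ [s] ++ [b])) ≤ ρ * ivlen (S.wordI (l ++ [s])) := by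
  obtain ⟨e, he, hsep⟩ := S.letter_sep
  obtain ⟨k, hk, hd⟩ := S.distortion
  obtain ⟨m, hm, hlen⟩ := S.len_const
  have hkey : ∀ l s b, S.IsWord (l ++ [s] ++ [b]) →
    ivlen (S.wordI (l ++ [s] ++ [b])) ≤ (1 - k * (e * m)) * ivlen (S.wordI (l ++ [s])) := by
    intro l s b hb
    obtain ⟨c, hcb, hcs⟩ := exists_third S.hr b (bar s)
    have hw := hb
    rw [isWord_concat] at hw
    have hc : S.IsWord (l ++ [s] ++ [c]) := S.isWord_concat.2 ⟨hw.1, hcs⟩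
    have hdis := S.sibling_disjoint hcb hc hb
    obtain ⟨hpos, h3⟩ := hd l s hw.1
    have h0 : S.ξ₀ c ∈ S.BI c := left_mem_Icc.2 (S.hlt c).le
    have h1 : S.ξ₁ c ∈ S.BI c := right_mem_Icc.2 (S.hlt c).le
    have hlow : k * (e * m) * ivlen (S.wordI (l ++ [s])) ≤ ivlen (S.wordI (l ++ [s] ++ [c])) := by
      rw [(S.ivlen_eq hc).2, wordγ_concat, mobius_mul _ _ _ (S.letter_map hcs h0).1,
        mobius_mul _ _ _ (S.letter_map hcs h1).1]
      have h4 := (h3 _ (S.letter_map hcs h0).2).1 _ (S.letter_map hcs h1).2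
      refine le_trans ?_ h4
      have h5 := hsep s c c hcs hcs _ h1 _ h0
      have h6 := (hlen c).trans (le_abs_self _)
      calc _ = k * ivlen (S.wordI (l ++ [s])) * (e * m) := by ring
        _ ≤ k * ivlen (S.wordI (l ++ [s])) * (e * |S.ξ₁ c - S.ξ₀ c|) := by gcongr
        _ ≤ _ := by gcongr
    have hsum : ivlen (S.wordI (l ++ [s] ++ [c])) + ivlen (S.wordI (l ++ [s] ++ [b])) ≤
        ivlen (S.wordI (l ++ [s])) := by
      have hbs := S.wordI_child_subset hb
      have hcs := S.wordI_child_subset hc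
      obtain ⟨u, v, huv⟩ := S.exists_Icc (by simp) hw.1
      obtain ⟨u1, v1, huv1⟩ := S.exists_Icc (by simp) hb
      obtain ⟨u2, v2, huv2⟩ := S.exists_Icc (by simp) hc
      unfold ivlen
      rw [huv] at hbs hcs ⊢
      rw [huv1] at hbs hdis ⊢
      rw [huv2] at hcs hdis ⊢
      rw [← ENNReal.toReal_add (by simp) (by simp), ← measure_union hdis measurableSet_Icc]
      exact ENNReal.toReal_mono (by simp) (measure_mono (union_subset hcs hbs))
    linarith
  refine ⟨max (1 - k * (e * m)) (1 / 2), by positivity, ?_, fun l s b h => ?_⟩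
  · rw [max_lt_iff]
    have : 0 < k * (e * m) := by positivity
    constructor
    · linarith
    · norm_num
  · refine (hkey l s b h).trans ?_
    have := S.ivlen_pos (by simp) (S.isWord_left h)
    gcongr
    exact le_max_left _ _

theorem contraction : ∃ ρ > 0, ρ < 1 ∧ ∀ l t, l ≠ [] → S.IsWord (l ++ t) →
    ivlen (S.wordI (l ++ t)) ≤ ρ ^ t.length * ivlen (S.wordI l) := by
  obtain ⟨ρ, h0, h1, h⟩ := S.contraction_step
  refine ⟨ρ, h0, h1, fun l t hl => ?_⟩
  induction t using List.reverseRecOn with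
  | nil => intro _; simp
  | append_singleton t b ih =>
    intro hw
    rw [← List.append_assoc] at hw ⊢
    have h2 := ih (S.isWord_left hw)
    obtain ⟨m, s, e⟩ := exists_concat (l := l ++ t) (by simp [hl])
    rw [e] at hw h2 ⊢
    refine (h m s b hw).trans ?_
    calc _ ≤ ρ * (ρ ^ t.length * ivlen (S.wordI l)) := by gcongr
      _ = _ := by simp; ring

end SchottkyData

namespace SchottkyData

variable {r : ℕ} (S : SchottkyData r)

theorem wordγ_mem (l : List (Fin (2 * r))) : S.wordγ l ∈ Subgroup.closure (Set.range S.γ) := by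
  unfold wordγ
  apply Subgroup.list_prod_mem
  intro g hg
  obtain ⟨a, _, rfl⟩ := List.mem_map.1 hg
  exact Subgroup.subset_closure ⟨a, rfl⟩

theorem measurable_derivB (g : SL2) (δ : ℝ) : Measurable fun x => mobiusDerivB g x ^ δ := by
  unfold mobiusDerivB mobiusDeriv mobius
  fun_prop

theorem conformal {δ : ℝ} (hδ0 : 0 < δ) {μ : Measure ℝ} (hμ : S.IsPS δ μ)
    {l : List (Fin (2 * r))} {b : Fin (2 * r)} (h : S.IsWord (l ++ [b])) :
    μ.real (S.wordI (l ++ [b])) = ∫ x in S.BI b, mobiusDerivB (S.wordγ l) x ^ δ ∂μ := by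
  have hm : MeasurableSet (S.wordI (l ++ [b])) := by
    rw [S.wordI_Icc h]
    exact measurableSet_Icc
  have h1 := hμ.2.2 _ (S.wordγ_mem l) ((S.wordI (l ++ [b])).indicator 1)
    (measurable_one.indicator hm) ⟨1, fun x => by
      by_cases hx : x ∈ S.wordI (l ++ [b]) <;> simp [hx]⟩
  rw [integral_indicator_one hm] at h1
  rw [h1, ← integral_indicator (by exact measurableSet_Icc)]
  congr 1
  funext x
  by_cases hx : x ∈ S.BI b
  · have : mobius (S.wordγ l) x ∈ S.wordI (l ++ [b]) := by
      rw [wordI_concat]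
      exact ⟨x, hx, rfl⟩
    simp [hx, this]
  · rw [indicator_of_notMem hx]
    by_cases hq : qden (S.wordγ l) x = 0
    · have : mobiusDerivB (S.wordγ l) x = 0 := by
        unfold mobiusDerivB mobiusDeriv
        unfold qden at hq
        rw [hq]
        simp
      rw [this, Real.zero_rpow hδ0.ne', mul_zero]
    · rw [indicator_of_notMem, zero_mul]
      rw [wordI_concat]
      rintro ⟨y, hy, e⟩
      rw [mobius_inj _ _ _ (S.qden_ne h hy) hq e] at hy
      exact hx hy

theorem measure_bounds {δ : ℝ} (hδ0 : 0 < δ) {μ : Measure ℝ} (hμ : S.IsPS δ μ) :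
    ∃ k > 0, ∀ l b, S.IsWord (l ++ [b]) →
      k * ivlen (S.wordI (l ++ [b])) ^ δ * μ.real (S.BI b) ≤ μ.real (S.wordI (l ++ [b])) ∧
      k * μ.real (S.wordI (l ++ [b])) ≤ ivlen (S.wordI (l ++ [b])) ^ δ := by
  have := hμ.1
  obtain ⟨k, hk, hd⟩ := S.distortion
  refine ⟨k ^ δ, by positivity, fun l b h => ?_⟩
  obtain ⟨hpos, h3⟩ := hd l b h
  have hms : MeasurableSet (S.BI b) := measurableSet_Icc
  rw [S.conformal hδ0 hμ h]
  generalize ivlen (S.wordI (l ++ [b])) = L at *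
  have hup : ∀ x ∈ S.BI b, mobiusDerivB (S.wordγ l) x ^ δ ≤ (L / k) ^ δ := by
    intro x hx
    have h1 := (h3 x hx).2.1
    have h2 := (h3 x hx).2.2
    apply Real.rpow_le_rpow _ _ hδ0.le
    · exact le_trans (by positivity) h1
    · rw [le_div_iff₀ hk]
      linarith
  have hdn : ∀ x ∈ S.BI b, (k * L) ^ δ ≤ mobiusDerivB (S.wordγ l) x ^ δ := by
    intro x hx
    exact Real.rpow_le_rpow (by positivity) (h3 x hx).2.1 hδ0.le
  have hIntg : IntegrableOn (fun x => mobiusDerivB (S.wordγ l) x ^ δ) (S.BI b) μ := by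
    refine Measure.integrableOn_of_bounded (M := (L / k) ^ δ) (measure_ne_top _ _)
      (measurable_derivB _ _).aestronglyMeasurable ?_
    rw [ae_restrict_iff' hms]
    filter_upwards with x hx
    rw [Real.norm_eq_abs, abs_of_nonneg]
    · exact hup x hx
    · exact le_trans (by positivity) (hdn x hx)
  constructor
  · have h1 := setIntegral_mono_on (integrableOn_const (measure_ne_top μ (S.BI b))) hIntg hms hdn
    rw [setIntegral_const, smul_eq_mul] at h1
    rw [← Real.mul_rpow hk.le hpos.le, mul_comm]
    exact h1
  · have h1 := setIntegral_mono_on hIntg (integrableOn_const (measure_ne_top μ (S.BI b))) hms hup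
    rw [setIntegral_const, smul_eq_mul] at h1
    have h2 : μ.real (S.BI b) ≤ 1 := measureReal_le_one
    have hpp : 0 ≤ (L / k) ^ δ := by positivity
    calc k ^ δ * _ ≤ k ^ δ * (1 * (L / k) ^ δ) := by
          gcongr
          exact h1.trans (by gcongr)
      _ = L ^ δ := by
          rw [one_mul, ← Real.mul_rpow hk.le (by positivity)]
          congr 1
          field_simp

theorem BI_pos {δ : ℝ} (hδ0 : 0 < δ) {μ : Measure ℝ} (hμ : S.IsPS δ μ) (b : Fin (2 * r)) :
    0 < μ.real (S.BI b) := by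
  have := hμ.1
  obtain ⟨k, hk, hb⟩ := S.measure_bounds hδ0 hμ
  have hstep : ∀ b c : Fin (2 * r), c ≠ bar b → 0 < μ.real (S.BI b) → 0 < μ.real (S.BI c) := by
    intro b c hbc hpos
    have hw : S.IsWord ([] ++ [c] ++ [b]) := S.isWord_concat.2 ⟨List.isChain_singleton _, bar_ne hbc⟩
    have h1 := (hb ([] ++ [c]) b hw).1
    have h2 := S.ivlen_pos (by simp) hw
    have h3 : 0 < k * ivlen (S.wordI ([] ++ [c] ++ [b])) ^ δ * μ.real (S.BI b) := by positivity
    refine (h3.trans_le h1).trans_le (measureReal_mono ?_)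
    have := S.wordI_child_subset hw
    rwa [List.nil_append, wordI_single] at this
  have hex : ∃ a, 0 < μ.real (S.BI a) := by
    by_contra! hcon
    have h0 : ∀ a, μ (S.BI a) = 0 := by
      intro a
      have := le_antisymm (hcon a) measureReal_nonneg
      rwa [measureReal_eq_zero_iff] at this
    have h1 : μ (⋃ a, S.BI a) = 0 := measure_iUnion_null h0
    have h2 : S.limitSet ⊆ ⋃ a, S.BI a := by
      intro x hx
      unfold limitSet at hx
      have := mem_iInter.1 hx 0
      simp only [mem_iUnion] at this
      obtain ⟨l, ⟨hw, hl⟩, hxl⟩ := this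
      obtain ⟨a, ha⟩ := S.wordI_sub_BI (l := l) (by rintro rfl; simp at hl) hw
      exact mem_iUnion.2 ⟨a, ha hxl⟩
    have h3 : μ univ = 0 := by
      rw [← union_compl_self S.limitSet]
      exact measure_union_null (measure_mono_null h2 h1) hμ.2.1
    simp at h3
  obtain ⟨a, ha⟩ := hex
  by_cases h : b = bar a
  · obtain ⟨c, h1, h2⟩ := exists_third S.hr a (bar a)
    have hc := hstep a c h2 ha
    apply hstep c b _ hc
    rw [h]
    intro h'
    apply h1
    rw [← bar_bar c, ← h', bar_bar]
  · exact hstep a b h ha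

theorem regular {δ : ℝ} (hδ0 : 0 < δ) {μ : Measure ℝ} (hμ : S.IsPS δ μ) :
    ∃ k > 0, ∀ l : List (Fin (2 * r)), l ≠ [] → S.IsWord l →
      k * ivlen (S.wordI l) ^ δ ≤ μ.real (S.wordI l) ∧
      k * μ.real (S.wordI l) ≤ ivlen (S.wordI l) ^ δ := by
  obtain ⟨k, hk, hb⟩ := S.measure_bounds hδ0 hμ
  obtain ⟨e, he, h⟩ := exists_pos_le _ (S.BI_pos hδ0 hμ)
  have := hμ.1
  have he1 : ∀ a : Fin (2 * r), e ≤ 1 := fun a => (h a).trans measureReal_le_one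
  refine ⟨k * e, by positivity, fun l hl hw => ?_⟩
  obtain ⟨m, b, rfl⟩ := exists_concat hl
  have hpos := S.ivlen_pos hl hw
  obtain ⟨h1, h2⟩ := hb m b hw
  constructor
  · refine le_trans ?_ h1
    have h3 := h b
    calc _ = k * ivlen (S.wordI (m ++ [b])) ^ δ * e := by ring
      _ ≤ _ := by gcongr
  · refine le_trans ?_ h2
    gcongr
    have := he1 b
    nlinarith

/-- A finite family of pairwise comparable words, indexed by depth below the deepest one. -/
theorem chain_index : ∃ ρ > 0, ρ < 1 ∧ ∀ (τ : ℝ) (G : Finset (List (Fin (2 * r)))) (x : ℝ),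
    (∀ a ∈ G, a ≠ [] ∧ S.IsWord a ∧ τ ≤ ivlen (S.wordI a) ∧ x ∈ S.wordI a) →
    ∃ j : List (Fin (2 * r)) → ℕ, InjOn j G ∧ ∀ a ∈ G, τ ≤ ρ ^ (j a) * ivlen (S.wordI a) := by
  obtain ⟨ρ, h0, h1, h⟩ := S.contraction
  refine ⟨ρ, h0, h1, fun τ G x hG => ?_⟩
  rcases G.eq_empty_or_nonempty with rfl | hne
  · exact ⟨fun _ => 0, by simp, by simp⟩
  obtain ⟨z, hz, hmax⟩ := G.exists_max_image List.length hne
  refine ⟨fun a => z.length - a.length, ?_, ?_⟩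
  · intro a ha b hb hab
    simp only at hab
    have ha' := hmax a ha
    have hb' := hmax b hb
    have hlen : a.length = b.length := by omega
    rcases S.comparable (hG a ha).2.1 (hG b hb).2.1 (hG a ha).2.2.2 (hG b hb).2.2.2 with h | h
    · exact h.eq_of_length hlen
    · exact (h.eq_of_length hlen.symm).symm
  · intro a ha
    have ha' := hmax a ha
    have hp : a <+: z := by
      rcases S.comparable (hG a ha).2.1 (hG z hz).2.1 (hG a ha).2.2.2 (hG z hz).2.2.2 with h | h
      · exact h
      · rw [h.eq_of_length (le_antisymm h.length_le ha')]
    obtain ⟨t, rfl⟩ := hp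
    have h2 := h a t (hG a ha).1 (hG _ hz).2.1
    have h3 := (hG _ hz).2.2.1
    simp only [List.length_append, Nat.add_sub_cancel_left]
    linarith

theorem chain_sum {δ : ℝ} (hδ0 : 0 < δ) : ∃ C > 0, ∀ (τ : ℝ) (G : Finset (List (Fin (2 * r))))
    (x : ℝ), 0 < τ →
    (∀ a ∈ G, a ≠ [] ∧ S.IsWord a ∧ τ ≤ ivlen (S.wordI a) ∧ x ∈ S.wordI a) →
    ∑ a ∈ G, (ivlen (S.wordI a) ^ δ)⁻¹ ≤ C * τ ^ (-δ) := by
  obtain ⟨ρ, h0, h1, h⟩ := S.chain_index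
  have hρ0 : 0 < ρ ^ δ := by positivity
  have hρ1 : ρ ^ δ < 1 := Real.rpow_lt_one h0.le h1 hδ0
  refine ⟨(1 - ρ ^ δ)⁻¹, inv_pos.2 (by linarith), fun τ G x hτ hG => ?_⟩
  obtain ⟨j, hj, hb⟩ := h τ G x hG
  calc ∑ a ∈ G, (ivlen (S.wordI a) ^ δ)⁻¹ ≤ ∑ a ∈ G, (ρ ^ δ) ^ (j a) * τ ^ (-δ) := by
        apply Finset.sum_le_sum
        intro a ha
        have hp := S.ivlen_pos (hG a ha).1 (hG a ha).2.1
        have h2 := Real.rpow_le_rpow hτ.le (hb a ha) hδ0.le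
        rw [Real.mul_rpow (by positivity) hp.le, ← Real.rpow_natCast, ← Real.rpow_mul h0.le,
          mul_comm _ δ, Real.rpow_mul h0.le, Real.rpow_natCast] at h2
        rw [Real.rpow_neg hτ.le, ← div_eq_mul_inv, inv_eq_one_div,
          div_le_div_iff₀ (by positivity) (by positivity)]
        linarith
    _ = (∑ a ∈ G, (ρ ^ δ) ^ (j a)) * τ ^ (-δ) := by rw [Finset.sum_mul]
    _ = (∑ n ∈ G.image j, (ρ ^ δ) ^ n) * τ ^ (-δ) := by rw [Finset.sum_image hj]
    _ ≤ (1 - ρ ^ δ)⁻¹ * τ ^ (-δ) := by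
        gcongr
        rw [← tsum_geometric_of_lt_one hρ0.le hρ1]
        exact (summable_geometric_of_lt_one hρ0.le hρ1).sum_le_tsum _
          (fun n _ => by positivity)

theorem chain_count : ∃ C > 0, ∀ (τ C₀ : ℝ) (G : Finset (List (Fin (2 * r))))
    (x : ℝ), 0 < τ → 2 ≤ C₀ →
    (∀ a ∈ G, a ≠ [] ∧ S.IsWord a ∧ τ ≤ ivlen (S.wordI a) ∧ ivlen (S.wordI a) ≤ C₀ * τ ∧
      x ∈ S.wordI a) → (G.card : ℝ) ≤ C * Real.log C₀ := by
  obtain ⟨ρ, h0, h1, h⟩ := S.chain_index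
  have hlρ : 0 < - Real.log ρ := by
    have := Real.log_neg h0 h1
    linarith
  have hl2 : 0 < Real.log 2 := Real.log_pos (by norm_num)
  refine ⟨(- Real.log ρ)⁻¹ + (Real.log 2)⁻¹, by positivity, fun τ C₀ G x hτ hC hG => ?_⟩
  obtain ⟨j, hj, hb⟩ := h τ G x fun a ha => ⟨(hG a ha).1, (hG a ha).2.1, (hG a ha).2.2.1,
    (hG a ha).2.2.2.2⟩
  have hlC : Real.log 2 ≤ Real.log C₀ := Real.log_le_log (by norm_num) hC
  have hB : 0 ≤ Real.log C₀ / (- Real.log ρ) := div_nonneg (by linarith) hlρ.le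
  have hcard : G.card ≤ ⌊Real.log C₀ / (- Real.log ρ)⌋₊ + 1 := by
    rw [← Finset.card_image_of_injOn hj, ← Finset.card_range (⌊_⌋₊ + 1)]
    apply Finset.card_le_card
    intro n hn
    obtain ⟨a, ha, rfl⟩ := Finset.mem_image.1 hn
    rw [Finset.mem_range, Nat.lt_succ_iff, Nat.le_floor_iff hB, le_div_iff₀ hlρ]
    have h2 := hb a ha
    have h3 : τ ≤ ρ ^ (j a) * (C₀ * τ) := h2.trans (by gcongr; exact (hG a ha).2.2.2.1)
    have h4 : 1 ≤ ρ ^ (j a) * C₀ := by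
      by_contra hcon
      push Not at hcon
      nlinarith
    have h5 := Real.log_le_log one_pos h4
    rw [Real.log_one, Real.log_mul (by positivity) (by positivity), Real.log_pow] at h5
    linarith
  have h6 : (G.card : ℝ) ≤ Real.log C₀ / (- Real.log ρ) + 1 := by
    calc (G.card : ℝ) ≤ (⌊Real.log C₀ / (- Real.log ρ)⌋₊ : ℝ) + 1 := by exact_mod_cast hcard
      _ ≤ _ := by
        gcongr
        exact Nat.floor_le hB
  have h7 : 1 ≤ (Real.log 2)⁻¹ * Real.log C₀ := by
    rw [inv_mul_eq_div, le_div_iff₀ hl2]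
    linarith
  calc _ ≤ _ := h6
    _ ≤ (- Real.log ρ)⁻¹ * Real.log C₀ + (Real.log 2)⁻¹ * Real.log C₀ := by
      rw [div_eq_inv_mul]
      gcongr
    _ = _ := by ring

/-- A finite family of words with intervals inside a set of diameter `≤ D` is captured by a
measurable set of measure `≲ D ^ δ`. -/
theorem capture {δ : ℝ} (hδ0 : 0 < δ) {μ : Measure ℝ} (hμ : S.IsPS δ μ) :
    ∃ C > 0, ∀ (G : Finset (List (Fin (2 * r)))) (j₀ j₁ : ℝ), j₀ ≤ j₁ → G.Nonempty →
    (∀ a ∈ G, a ≠ [] ∧ S.IsWord a ∧ S.wordI a ⊆ Icc j₀ j₁) →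
    ∃ P, MeasurableSet P ∧ (∀ a ∈ G, S.wordI a ⊆ P) ∧ μ.real P ≤ C * (j₁ - j₀) ^ δ := by
  have := hμ.1
  obtain ⟨k, hk, hreg⟩ := S.regular hδ0 hμ
  obtain ⟨e, he, hsep⟩ := S.separation
  obtain ⟨d, hd, hgap⟩ := S.gap_const
  refine ⟨k⁻¹ + k⁻¹ * (e ^ δ)⁻¹ + (d ^ δ)⁻¹, by positivity, fun G j₀ j₁ hj hne hG => ?_⟩
  have hJ : 0 ≤ (j₁ - j₀) ^ δ := Real.rpow_nonneg (by linarith) _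
  have hmeas : ∀ a, a ≠ [] → S.IsWord a → MeasurableSet (S.wordI a) := by
    intro a h1 h2
    obtain ⟨u, v, h⟩ := S.exists_Icc h1 h2
    rw [h]
    exact measurableSet_Icc
  have hnonempty : ∀ a, a ≠ [] → S.IsWord a → (S.wordI a).Nonempty := by
    intro a h1 h2
    rw [nonempty_iff_ne_empty]
    intro h
    have := S.ivlen_pos h1 h2
    rw [h] at this
    simp [ivlen] at this
  obtain ⟨z, hz⟩ := hne
  classical
  set n := Nat.findGreatest (fun n => ∀ a ∈ G, z.take n <+: a) z.length with hn
  have hspec : ∀ a ∈ G, z.take n <+: a :=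
    Nat.findGreatest_spec (P := fun n => ∀ a ∈ G, z.take n <+: a) (Nat.zero_le _) (by simp)
  by_cases hpG : z.take n ∈ G
  · -- the common prefix is itself a member
    obtain ⟨h1, h2, h3⟩ := hG _ hpG
    refine ⟨S.wordI (z.take n), hmeas _ h1 h2,
      fun a ha => S.wordI_mono h1 (hG a ha).2.1 (hspec a ha), ?_⟩
    have h4 := (hreg _ h1 h2).2
    have h5 : ivlen (S.wordI (z.take n)) ≤ j₁ - j₀ := by
      unfold ivlen
      have := ENNReal.toReal_mono (by simp) (measure_mono (μ := volume) h3)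
      rwa [Real.volume_Icc, ENNReal.toReal_ofReal (by linarith)] at this
    have h6 := Real.rpow_le_rpow (S.ivlen_pos h1 h2).le h5 hδ0.le
    calc μ.real (S.wordI (z.take n)) = k⁻¹ * (k * μ.real (S.wordI (z.take n))) := by field_simp
      _ ≤ k⁻¹ * (j₁ - j₀) ^ δ := by gcongr; exact h4.trans h6
      _ ≤ _ := by
        gcongr
        have : 0 < k⁻¹ * (e ^ δ)⁻¹ := by positivity
        have : 0 < (d ^ δ)⁻¹ := by positivity
        linarith
  · -- branching
    have hnz : n < z.length := by
      by_contra hcon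
      rw [List.take_of_length_le (not_lt.1 hcon)] at hpG
      exact hpG hz
    have hnot : ¬ ∀ a ∈ G, z.take (n + 1) <+: a := by
      intro hcon
      have := Nat.le_findGreatest (P := fun n => ∀ a ∈ G, z.take n <+: a) (m := n + 1)
        (n := z.length) hnz hcon
      omega
    push Not at hnot
    obtain ⟨a, ha, hna⟩ := hnot
    have htake : z.take (n + 1) = z.take n ++ [z[n]] := by simp
    obtain ⟨u, hu⟩ := hspec a ha
    have hzd : z = z.take n ++ [z[n]] ++ z.drop (n + 1) := by
      rw [← htake, List.take_append_drop]
    generalize z.take n = p at *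
    generalize z[n] = b at *
    rw [htake] at hna
    cases u with
    | nil =>
      simp at hu
      exact absurd (hu ▸ ha) hpG
    | cons c u =>
      have hac : a = p ++ [c] ++ u := by rw [← hu]; simp
      have hbc : b ≠ c := by
        rintro rfl
        exact hna ⟨u, hac.symm⟩
      have hwb : S.IsWord (p ++ [b]) := by
        have := (hG z hz).2.1
        rw [hzd] at this
        exact S.isWord_left this
      have hwc : S.IsWord (p ++ [c]) := by
        have := (hG a ha).2.1
        rw [hac] at this
        exact S.isWord_left this
      obtain ⟨x, hx⟩ := hnonempty z (hG z hz).1 (hG z hz).2.1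
      obtain ⟨y, hy⟩ := hnonempty a (hG a ha).1 (hG a ha).2.1
      have hxJ := (hG z hz).2.2 hx
      have hyJ := (hG a ha).2.2 hy
      have hxb := S.wordI_mono (l := p ++ [b]) (by simp) (hG z hz).2.1 ⟨_, hzd.symm⟩ hx
      have hyc := S.wordI_mono (l := p ++ [c]) (by simp) (hG a ha).2.1 ⟨_, hac.symm⟩ hy
      have hxy : |x - y| ≤ j₁ - j₀ := by
        obtain ⟨_, _⟩ := hxJ
        obtain ⟨_, _⟩ := hyJ
        rw [abs_le]
        constructor <;> linarith
      by_cases hp : p = []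
      · subst hp
        refine ⟨univ, MeasurableSet.univ, fun _ _ => subset_univ _, ?_⟩
        rw [List.nil_append, wordI_single] at hxb hyc
        have h1 := (hgap b c hbc x hxb y hyc).trans hxy
        have h2 := Real.rpow_le_rpow hd.le h1 hδ0.le
        calc μ.real univ = 1 := by simp
          _ = (d ^ δ)⁻¹ * d ^ δ := by field_simp
          _ ≤ (d ^ δ)⁻¹ * (j₁ - j₀) ^ δ := by gcongr
          _ ≤ _ := by
            gcongr
            have : 0 < k⁻¹ * (e ^ δ)⁻¹ := by positivity
            have : 0 < k⁻¹ := by positivity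
            linarith
      · have hwp := S.isWord_left hwb
        refine ⟨S.wordI p, hmeas _ hp hwp,
          fun a ha => S.wordI_mono hp (hG a ha).2.1 (hspec a ha), ?_⟩
        have h4 := (hreg _ hp hwp).2
        have h5 := (hsep p hp b c hbc hwb hwc x hxb y hyc).trans hxy
        have hpos := S.ivlen_pos hp hwp
        have h6 := Real.rpow_le_rpow (by positivity) h5 hδ0.le
        rw [Real.mul_rpow he.le hpos.le] at h6
        calc μ.real (S.wordI p) = k⁻¹ * (k * μ.real (S.wordI p)) := by field_simp
          _ ≤ k⁻¹ * (ivlen (S.wordI p) ^ δ) := by gcongr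
          _ = k⁻¹ * ((e ^ δ)⁻¹ * (e ^ δ * ivlen (S.wordI p) ^ δ)) := by field_simp
          _ ≤ k⁻¹ * ((e ^ δ)⁻¹ * (j₁ - j₀) ^ δ) := by gcongr
          _ = k⁻¹ * (e ^ δ)⁻¹ * (j₁ - j₀) ^ δ := by ring
          _ ≤ _ := by
            gcongr
            have : 0 < (d ^ δ)⁻¹ := by positivity
            have : 0 < k⁻¹ := by positivity
            linarith

theorem inside_count {δ : ℝ} (hδ0 : 0 < δ) {μ : Measure ℝ} (hμ : S.IsPS δ μ) :
    ∃ C > 0, ∀ (τ : ℝ) (G : Finset (List (Fin (2 * r)))) (j₀ j₁ : ℝ), 0 < τ → j₀ ≤ j₁ →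
    (∀ a ∈ G, a ≠ [] ∧ S.IsWord a ∧ τ ≤ ivlen (S.wordI a) ∧ S.wordI a ⊆ Icc j₀ j₁) →
    (G.card : ℝ) ≤ C * τ ^ (-δ) * (j₁ - j₀) ^ δ := by
  have := hμ.1
  obtain ⟨k, hk, hreg⟩ := S.regular hδ0 hμ
  obtain ⟨C₁, hC₁, hsum⟩ := S.chain_sum hδ0
  obtain ⟨C₂, hC₂, hcap⟩ := S.capture hδ0 hμ
  refine ⟨k⁻¹ * (C₁ * C₂), by positivity, fun τ G j₀ j₁ hτ hj hG => ?_⟩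
  have hJ : 0 ≤ (j₁ - j₀) ^ δ := Real.rpow_nonneg (by linarith) _
  rcases G.eq_empty_or_nonempty with rfl | hne
  · simp
    positivity
  obtain ⟨P, hPm, hP, hPμ⟩ := hcap G j₀ j₁ hj hne
    fun a ha => ⟨(hG a ha).1, (hG a ha).2.1, (hG a ha).2.2.2⟩
  have hmeas : ∀ a ∈ G, MeasurableSet (S.wordI a) := by
    intro a ha
    obtain ⟨u, v, h⟩ := S.exists_Icc (hG a ha).1 (hG a ha).2.1
    rw [h]
    exact measurableSet_Icc
  have hIntg : ∀ a ∈ G, Integrable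
      ((S.wordI a).indicator fun _ => (ivlen (S.wordI a) ^ δ)⁻¹) μ := fun a ha =>
    (integrable_const _).indicator (hmeas a ha)
  have hle : ∀ x, ∑ a ∈ G, (S.wordI a).indicator (fun _ => (ivlen (S.wordI a) ^ δ)⁻¹) x ≤
      P.indicator (fun _ => C₁ * τ ^ (-δ)) x := by
    classical
    intro x
    have h1 : ∑ a ∈ G, (S.wordI a).indicator (fun _ => (ivlen (S.wordI a) ^ δ)⁻¹) x =
        ∑ a ∈ G with x ∈ S.wordI a, (ivlen (S.wordI a) ^ δ)⁻¹ := by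
      rw [Finset.sum_filter]
      apply Finset.sum_congr rfl
      intro a _
      simp [indicator_apply]
    by_cases hx : x ∈ P
    · rw [indicator_of_mem hx, h1]
      apply hsum τ _ x hτ
      intro a ha
      obtain ⟨ha, hxa⟩ := Finset.mem_filter.1 ha
      exact ⟨(hG a ha).1, (hG a ha).2.1, (hG a ha).2.2.1, hxa⟩
    · rw [indicator_of_notMem hx]
      apply le_of_eq
      apply Finset.sum_eq_zero
      intro a ha
      exact indicator_of_notMem (fun h => hx (hP a ha h)) _
  have hcard : (G.card : ℝ) ≤ k⁻¹ * (μ.real P * (C₁ * τ ^ (-δ))) := by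
    calc (G.card : ℝ) = ∑ a ∈ G, (1 : ℝ) := by simp
      _ ≤ ∑ a ∈ G, k⁻¹ * (μ.real (S.wordI a) * (ivlen (S.wordI a) ^ δ)⁻¹) := by
        apply Finset.sum_le_sum
        intro a ha
        have hp := S.ivlen_pos (hG a ha).1 (hG a ha).2.1
        have h1 := (hreg a (hG a ha).1 (hG a ha).2.1).1
        have hp' : 0 < ivlen (S.wordI a) ^ δ := by positivity
        calc (1 : ℝ) = k⁻¹ * ((k * ivlen (S.wordI a) ^ δ) * (ivlen (S.wordI a) ^ δ)⁻¹) := by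
              field_simp
          _ ≤ _ := by gcongr
      _ = k⁻¹ * ∑ a ∈ G, ∫ x, (S.wordI a).indicator
            (fun _ => (ivlen (S.wordI a) ^ δ)⁻¹) x ∂μ := by
        rw [Finset.mul_sum]
        apply Finset.sum_congr rfl
        intro a ha
        rw [integral_indicator_const _ (hmeas a ha), smul_eq_mul]
      _ = k⁻¹ * ∫ x, ∑ a ∈ G, (S.wordI a).indicator
            (fun _ => (ivlen (S.wordI a) ^ δ)⁻¹) x ∂μ := by
        rw [integral_finsetSum _ hIntg]
      _ ≤ k⁻¹ * ∫ x, P.indicator (fun _ => C₁ * τ ^ (-δ)) x ∂μ := by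
        refine mul_le_mul_of_nonneg_left ?_ (by positivity)
        exact integral_mono (integrable_finsetSum _ hIntg)
          ((integrable_const _).indicator hPm) hle
      _ = _ := by rw [integral_indicator_const _ hPm, smul_eq_mul]
  calc (G.card : ℝ) ≤ _ := hcard
    _ ≤ k⁻¹ * ((C₂ * (j₁ - j₀) ^ δ) * (C₁ * τ ^ (-δ))) := by gcongr
    _ = _ := by ring

end SchottkyData

/-- **Counting intervals of comparable size meeting a given interval:** there is `C_Γ > 0`
depending only on the Schottky data such that for every `τ ∈ (0,1]`, every interval
`J = [j₀,j₁]` and every `C₀ ≥ 2`: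
`#{𝐚 ∈ W° : τ ≤ |I_𝐚| ≤ C₀τ, I_𝐚 ∩ J ≠ ∅} ≤ C_Γ τ^{-δ}|J|^δ + C_Γ log C₀`. -/
theorem interval_counting (r : ℕ) (S : SchottkyData r) (δ : ℝ)
    (hδ0 : 0 < δ) (hδ1 : δ < 1) (μ : Measure ℝ) (hμ : S.IsPS δ μ) :
    ∃ C > (0 : ℝ), ∀ τ : ℝ, 0 < τ → τ ≤ 1 → ∀ j₀ j₁ : ℝ, j₀ ≤ j₁ →
      ∀ C₀ : ℝ, 2 ≤ C₀ →
      (Set.ncard {l : List (Fin (2 * r)) | S.IsWord l ∧ l ≠ [] ∧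
          τ ≤ ivlen (S.wordI l) ∧ ivlen (S.wordI l) ≤ C₀ * τ ∧
          (S.wordI l ∩ Icc j₀ j₁).Nonempty} : ℝ)
        ≤ C * τ ^ (-δ) * (j₁ - j₀) ^ δ + C * Real.log C₀ := by
  classical
  obtain ⟨C₁, hC₁, hin⟩ := S.inside_count hδ0 hμ
  obtain ⟨C₂, hC₂, hch⟩ := S.chain_count
  refine ⟨C₁ + 2 * C₂, by positivity, fun τ hτ _ j₀ j₁ hj C₀ hC => ?_⟩
  have hJ : 0 ≤ (j₁ - j₀) ^ δ := Real.rpow_nonneg (by linarith) _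
  have hlog : 0 ≤ Real.log C₀ := Real.log_nonneg (by linarith)
  set A := {l : List (Fin (2 * r)) | S.IsWord l ∧ l ≠ [] ∧
          τ ≤ ivlen (S.wordI l) ∧ ivlen (S.wordI l) ≤ C₀ * τ ∧
          (S.wordI l ∩ Icc j₀ j₁).Nonempty} with hA
  by_cases hfin : A.Finite
  swap
  · rw [Set.Infinite.ncard hfin]
    simp
    positivity
  rw [Set.ncard_eq_toFinset_card A hfin]
  have hmem : ∀ a ∈ hfin.toFinset, S.IsWord a ∧ a ≠ [] ∧
          τ ≤ ivlen (S.wordI a) ∧ ivlen (S.wordI a) ≤ C₀ * τ ∧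
          (S.wordI a ∩ Icc j₀ j₁).Nonempty := fun a ha => hfin.mem_toFinset.1 ha
  generalize hfin.toFinset = F at *
  have hsub : F ⊆ (F.filter fun a => j₀ ∈ S.wordI a) ∪ ((F.filter fun a => j₁ ∈ S.wordI a) ∪
      (F.filter fun a => S.wordI a ⊆ Icc j₀ j₁)) := by
    intro a ha
    obtain ⟨hw, hne, -, -, x, hx, hxJ⟩ := hmem a ha
    obtain ⟨u, v, huv⟩ := S.exists_Icc hne hw
    simp only [Finset.mem_union, Finset.mem_filter, ha, true_and]
    rw [huv] at hx ⊢
    by_cases h0 : j₀ ∈ Icc u v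
    · exact Or.inl h0
    by_cases h1 : j₁ ∈ Icc u v
    · exact Or.inr (Or.inl h1)
    right; right
    obtain ⟨hx1, hx2⟩ := hx
    obtain ⟨hx3, hx4⟩ := hxJ
    have h2 : j₀ ≤ u := by
      by_contra hcon
      exact h0 ⟨by linarith, by linarith⟩
    have h3 : v ≤ j₁ := by
      by_contra hcon
      exact h1 ⟨by linarith, by linarith⟩
    exact Icc_subset_Icc h2 h3
  have hc := (Finset.card_le_card hsub).trans ((Finset.card_union_le _ _).trans
    (Nat.add_le_add_left (Finset.card_union_le _ _) _))
  have hc' : (F.card : ℝ) ≤ ((F.filter fun a => j₀ ∈ S.wordI a).card : ℝ) +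
      (((F.filter fun a => j₁ ∈ S.wordI a).card : ℝ) +
      ((F.filter fun a => S.wordI a ⊆ Icc j₀ j₁).card : ℝ)) := by exact_mod_cast hc
  have e0 := hch τ C₀ (F.filter fun a => j₀ ∈ S.wordI a) j₀ hτ hC (by
    intro a ha
    obtain ⟨ha, hx⟩ := Finset.mem_filter.1 ha
    obtain ⟨h1, h2, h3, h4, _⟩ := hmem a ha
    exact ⟨h2, h1, h3, h4, hx⟩)
  have e1 := hch τ C₀ (F.filter fun a => j₁ ∈ S.wordI a) j₁ hτ hC (by
    intro a ha
    obtain ⟨ha, hx⟩ := Finset.mem_filter.1 ha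
    obtain ⟨h1, h2, h3, h4, _⟩ := hmem a ha
    exact ⟨h2, h1, h3, h4, hx⟩)
  have e2 := hin τ (F.filter fun a => S.wordI a ⊆ Icc j₀ j₁) j₀ j₁ hτ hj (by
    intro a ha
    obtain ⟨ha, hx⟩ := Finset.mem_filter.1 ha
    obtain ⟨h1, h2, h3, h4, _⟩ := hmem a ha
    exact ⟨h2, h1, h3, hx⟩)
  have p1 : 0 ≤ 2 * C₂ * (τ ^ (-δ) * (j₁ - j₀) ^ δ) := by positivity
  have p2 : 0 ≤ C₁ * Real.log C₀ := by positivity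
  nlinarith


end
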